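/- For every n ≥ 0 the cardinalities |T_n|, σ_n = |S_n^1|, ρ_n = |R_n| satisfy the recursion |T_{n+1}| = 6|T_n|²σ_n, σ_{n+1} = 7|T_n|σ_n² + |T_n|²ρ_n, ρ_{n+1} = 14σ_n³ + 12|T_n|σ_nρ_n, with initial values |T_0| = 3, σ_0 = 1, ρ_0 = 1. -/

import Mathlib

attribute [local instance] Classical.propDecidable

noncomputable section

/-- Points in the plane. -/
abbrev Pt : Type := ℝ × ℝ

/-- The three corner vertices `u₁ = (0,0)`, `u₂ = (1,0)`, `u₃ = (1/2, √3/2)`. -/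
def cornerPt : Fin 3 → Pt
  | 0 => (0, 0)
  | 1 => (1, 0)
  | 2 => (1 / 2, Real.sqrt 3 / 2)

/-- The similitude `ψ_i(x) = (x + u_i)/2`. -/
def psi (i : Fin 3) (x : Pt) : Pt := ((x.1 + (cornerPt i).1) / 2, (x.2 + (cornerPt i).2) / 2)

/-- Vertex set of the Sierpiński graph `G_n`. -/
def sierpV : ℕ → Finset Pt
  | 0 => {cornerPt 0, cornerPt 1, cornerPt 2}
  | n + 1 => (sierpV n).image (psi 0) ∪ (sierpV n).image (psi 1) ∪ (sierpV n).image (psi 2)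

/-- Edge set of the Sierpiński graph `G_n`. -/
def sierpE : ℕ → Finset (Sym2 Pt)
  | 0 => {s(cornerPt 0, cornerPt 1), s(cornerPt 1, cornerPt 2), s(cornerPt 2, cornerPt 0)}
  | n + 1 =>
      (sierpE n).image (Sym2.map (psi 0)) ∪ (sierpE n).image (Sym2.map (psi 1)) ∪
        (sierpE n).image (Sym2.map (psi 2))

/-- The simple graph spanned by a finite set of edges. -/
def graphOf (F : Finset (Sym2 Pt)) : SimpleGraph Pt := SimpleGraph.fromEdgeSet ↑F

/-- Spanning trees of `G_n`: acyclic edge subsets connecting all vertices of `G_n`. -/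
def treeSet (n : ℕ) : Finset (Finset (Sym2 Pt)) :=
  (sierpE n).powerset.filter fun F =>
    (graphOf F).IsAcyclic ∧ ∀ x ∈ sierpV n, ∀ y ∈ sierpV n, (graphOf F).Reachable x y

/-- `S_n^i` (with `i : Fin 3` zero-based): spanning forests of `G_n` with exactly two
components, one containing corner `i`, the other containing the two remaining corners. -/
def twoForestSet (n : ℕ) (i : Fin 3) : Finset (Finset (Sym2 Pt)) :=
  (sierpE n).powerset.filter fun F =>
    (graphOf F).IsAcyclic ∧
    (∀ j, j ≠ i → ¬ (graphOf F).Reachable (cornerPt i) (cornerPt j)) ∧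
    (∀ j k, j ≠ i → k ≠ i → (graphOf F).Reachable (cornerPt j) (cornerPt k)) ∧
    (∀ x ∈ sierpV n, ∃ j, (graphOf F).Reachable (cornerPt j) x)

/-- `R_n`: spanning forests of `G_n` with exactly three components, each containing
exactly one corner vertex. -/
def threeForestSet (n : ℕ) : Finset (Finset (Sym2 Pt)) :=
  (sierpE n).powerset.filter fun F =>
    (graphOf F).IsAcyclic ∧
    (∀ j k, j ≠ k → ¬ (graphOf F).Reachable (cornerPt j) (cornerPt k)) ∧
    (∀ x ∈ sierpV n, ∃ j, (graphOf F).Reachable (cornerPt j) x)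

/-- Edges of the copy `ψ_i(G_n)` inside `G_{n+1}`. -/
def psiCellE (i : Fin 3) (n : ℕ) : Finset (Sym2 Pt) := (sierpE n).image (Sym2.map (psi i))

/-- The class `T_n^i`: for `n ≥ 1`, spanning trees whose unique path from corner `i`
to any other corner `j` stays in `ψ_i(G_{n-1}) ∪ ψ_j(G_{n-1})`; for `n = 0` the
singleton consisting of the two edges of `G_0` incident with corner `i`. -/
def treeClass : ℕ → Fin 3 → Finset (Finset (Sym2 Pt))
  | 0, i => {(sierpE 0).filter fun e => cornerPt i ∈ e}
  | n + 1, i =>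
      (treeSet (n + 1)).filter fun F =>
        ∀ j, j ≠ i → ∀ p : (graphOf F).Walk (cornerPt i) (cornerPt j), p.IsPath →
          ∀ e ∈ p.edges, e ∈ psiCellE i n ∪ psiCellE j n

/-- `ψ_w = ψ_{w₁} ∘ ⋯ ∘ ψ_{w_k}` for a word `w` of length `k`. -/
def psiWord {k : ℕ} (w : Fin k → Fin 3) : Pt → Pt :=
  (List.ofFn w).foldr (fun i g => psi i ∘ g) id

/-- The restriction `π_w(F) = ψ_w^{-1}(F ∩ ψ_w(G_{m-k}))` of an edge set `F ⊆ E G_m`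
to the `k`-part indexed by the word `w`, as a subgraph of `G_{m-k}`. -/
def restrictE {k : ℕ} (w : Fin k → Fin 3) (m : ℕ) (F : Finset (Sym2 Pt)) :
    Finset (Sym2 Pt) :=
  (sierpE (m - k)).filter fun e => Sym2.map (psiWord w) e ∈ F

/-- Number of connected components of the subgraph with edge set `F`,
on the vertex set of `G_m`. -/
def ncomp (m : ℕ) (F : Finset (Sym2 Pt)) : ℕ :=
  Set.ncard {C : Set Pt | ∃ v ∈ sierpV m, C = {x : Pt | x ∈ sierpV m ∧ (graphOf F).Reachable v x}}

/-- Degree of `v` in the edge set `F`. -/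
def degIn (F : Finset (Sym2 Pt)) (v : Pt) : ℕ := (F.filter fun e => v ∈ e).card

/-- The subgraph of `G_0` replacing a forest in `Q_1`, used in the trace construction. -/
def traceCell (g : Finset (Sym2 Pt)) : Finset (Sym2 Pt) :=
  if g ∈ treeClass 1 0 then (sierpE 0).filter (fun e => cornerPt 0 ∈ e)
  else if g ∈ treeClass 1 1 then (sierpE 0).filter (fun e => cornerPt 1 ∈ e)
  else if g ∈ treeClass 1 2 then (sierpE 0).filter (fun e => cornerPt 2 ∈ e)
  else if g ∈ twoForestSet 1 0 then (sierpE 0).filter (fun e => cornerPt 0 ∉ e)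
  else if g ∈ twoForestSet 1 1 then (sierpE 0).filter (fun e => cornerPt 1 ∉ e)
  else if g ∈ twoForestSet 1 2 then (sierpE 0).filter (fun e => cornerPt 2 ∉ e)
  else ∅

/-- The trace `Tr f ⊆ E G_n` of an edge set `f ⊆ E G_{n+1}`. -/
def trace (n : ℕ) (f : Finset (Sym2 Pt)) : Finset (Sym2 Pt) :=
  Finset.univ.biUnion fun w : Fin n → Fin 3 =>
    (traceCell (restrictE w (n + 1) f)).image (Sym2.map (psiWord w))

/-- `Q_n = T_n ∪ S_n^1 ∪ S_n^2 ∪ S_n^3 ∪ R_n`. -/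
def qSet (n : ℕ) : Finset (Finset (Sym2 Pt)) :=
  treeSet n ∪ twoForestSet n 0 ∪ twoForestSet n 1 ∪ twoForestSet n 2 ∪ threeForestSet n

theorem reachable_sup_edge_cases {α : Type*} {G : SimpleGraph α} {u v x y : α}
    (h : (G ⊔ SimpleGraph.edge u v).Reachable x y) :
    G.Reachable x y ∨ (G.Reachable x u ∧ G.Reachable v y) ∨
      (G.Reachable x v ∧ G.Reachable u y) := by
  obtain ⟨w⟩ := h
  induction w with
  | nil => exact Or.inl (SimpleGraph.Reachable.refl _)
  | @cons a b c hab _ ih =>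
    rw [SimpleGraph.sup_adj, SimpleGraph.edge_adj] at hab
    rcases hab with hab | ⟨⟨rfl, rfl⟩ | ⟨rfl, rfl⟩, -⟩
    · rcases ih with h | ⟨h, h'⟩ | ⟨h, h'⟩
      · exact Or.inl (hab.reachable.trans h)
      · exact Or.inr (Or.inl ⟨hab.reachable.trans h, h'⟩)
      · exact Or.inr (Or.inr ⟨hab.reachable.trans h, h'⟩)
    · rcases ih with h | ⟨-, h'⟩ | ⟨-, h'⟩
      · exact Or.inr (Or.inl ⟨.rfl, h⟩)
      · exact Or.inr (Or.inl ⟨.rfl, h'⟩)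
      · exact Or.inl h'
    · rcases ih with h | ⟨-, h⟩ | ⟨-, h⟩
      · exact Or.inr (Or.inr ⟨.rfl, h⟩)
      · exact Or.inl h
      · exact Or.inr (Or.inr ⟨.rfl, h⟩)

/-- `T` meets every connected component of `G` that meets `V` in exactly one vertex. -/
def IsTransversal {α : Type*} (G : SimpleGraph α) (V T : Finset α) : Prop :=
  T ⊆ V ∧ (∀ x ∈ V, ∃ t ∈ T, G.Reachable t x) ∧ ∀ t ∈ T, ∀ s ∈ T, G.Reachable t s → t = s

theorem IsTransversal.insert_of_sup_edge {α : Type*} [DecidableEq α] {G : SimpleGraph α}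
    {V T : Finset α} {u v t : α} (hT : IsTransversal (G ⊔ SimpleGraph.edge u v) V T)
    (huv : ¬ G.Reachable u v) (hv : v ∈ V) (ht : t ∈ T) (htu : G.Reachable t u) :
    v ∉ T ∧ IsTransversal G V (insert v T) := by
  obtain ⟨hTV, hT₁, hT₂⟩ := hT
  have hne : u ≠ v := fun h => huv (h ▸ .rfl)
  have hmono {a b : α} (h : G.Reachable a b) : (G ⊔ SimpleGraph.edge u v).Reachable a b :=
    h.mono le_sup_left
  have hadj : (G ⊔ SimpleGraph.edge u v).Reachable u v := by
    refine SimpleGraph.Adj.reachable ?_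
    simp [SimpleGraph.edge_adj, hne]
  have key : ∀ s ∈ T, ¬ G.Reachable s v := fun s hs hsv => by
    have := hT₂ t ht s hs (((hmono htu).trans hadj).trans (hmono hsv.symm))
    subst this
    exact huv (htu.symm.trans hsv)
  refine ⟨fun h => key v h .rfl, Finset.insert_subset hv hTV, fun x hx => ?_, ?_⟩
  · obtain ⟨s, hs, hsx⟩ := hT₁ x hx
    rcases reachable_sup_edge_cases hsx with h | ⟨-, h⟩ | ⟨h, -⟩
    · exact ⟨s, Finset.mem_insert_of_mem hs, h⟩
    · exact ⟨v, Finset.mem_insert_self _ _, h⟩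
    · exact absurd h (key s hs)
  · intro a ha b hb hab
    rcases Finset.mem_insert.1 ha with rfl | ha' <;> rcases Finset.mem_insert.1 hb with rfl | hb'
    · rfl
    · exact absurd hab.symm (key b hb')
    · exact absurd hab (key a ha')
    · exact hT₂ a ha' b hb' (hmono hab)

theorem IsTransversal.card_le_and_isAcyclic_iff {α : Type*} [DecidableEq α] (V : Finset α)
    (F : Finset (Sym2 α)) (hF : ∀ e ∈ F, ¬ e.IsDiag ∧ ∀ x ∈ e, x ∈ V) (T : Finset α)
    (hT : IsTransversal (SimpleGraph.fromEdgeSet (F : Set (Sym2 α))) V T) :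
    V.card ≤ F.card + T.card ∧
      ((SimpleGraph.fromEdgeSet (F : Set (Sym2 α))).IsAcyclic ↔ F.card + T.card = V.card) := by
  induction F using Finset.induction_on generalizing T with
  | empty =>
    simp only [Finset.coe_empty, SimpleGraph.fromEdgeSet_empty] at hT ⊢
    have : T = V := by
      refine hT.1.antisymm fun x hx => ?_
      obtain ⟨t, ht, h⟩ := hT.2.1 x hx
      rw [SimpleGraph.reachable_bot] at h
      exact h ▸ ht
    simp [this]
  | @insert e F he ih =>
    have hF' : ∀ e ∈ F, ¬ e.IsDiag ∧ ∀ x ∈ e, x ∈ V :=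
      fun e he => hF e (Finset.mem_insert_of_mem he)
    have hev := hF e (Finset.mem_insert_self _ _)
    clear hF
    induction e with | _ u v
    set G := SimpleGraph.fromEdgeSet (F : Set (Sym2 α)) with hG
    have hGe : SimpleGraph.fromEdgeSet ((insert s(u, v) F : Finset (Sym2 α)) : Set (Sym2 α)) =
        G ⊔ SimpleGraph.edge u v := by
      ext x y
      simp only [hG, SimpleGraph.sup_adj, SimpleGraph.edge_adj, SimpleGraph.fromEdgeSet_adj,
        Finset.coe_insert, Set.mem_insert_iff, Sym2.eq_iff]
      tauto
    rw [hGe] at hT ⊢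
    have hne : u ≠ v := by simpa using hev.1
    have hu : u ∈ V := hev.2 u (by simp)
    have hv : v ∈ V := hev.2 v (by simp)
    rw [Finset.card_insert_of_notMem he]
    by_cases huv : G.Reachable u v
    · have hreach : ∀ x y, (G ⊔ SimpleGraph.edge u v).Reachable x y ↔ G.Reachable x y := by
        refine fun x y => ⟨fun h => ?_, fun h => h.mono le_sup_left⟩
        rcases reachable_sup_edge_cases h with h | ⟨h, h'⟩ | ⟨h, h'⟩
        · exact h
        · exact (h.trans huv).trans h'
        · exact (h.trans huv.symm).trans h'
      have hT' : IsTransversal G V T := by simpa only [IsTransversal, hreach] using hT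
      have hcard := (ih hF' T hT').1
      have hnadj : ¬ G.Adj u v := by
        simp only [hG, SimpleGraph.fromEdgeSet_adj, Finset.mem_coe]
        exact fun h => he h.1
      have hcyc : ¬ (G ⊔ SimpleGraph.edge u v).IsAcyclic := fun h =>
        ((SimpleGraph.isAcyclic_sup_fromEdgeSet_iff.1 h).2 huv).elim hne hnadj
      exact ⟨by omega, iff_of_false hcyc (by omega)⟩
    · obtain ⟨T', hT', hcard⟩ : ∃ T', IsTransversal G V T' ∧ T'.card = T.card + 1 := by
        obtain ⟨t, ht, htu⟩ := hT.2.1 u hu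
        have : G.Reachable t u ∨ G.Reachable t v := by
          rcases reachable_sup_edge_cases htu with h | ⟨h, -⟩ | ⟨h, -⟩ <;> tauto
        rcases this with h | h
        · have := hT.insert_of_sup_edge huv hv ht h
          exact ⟨_, this.2, Finset.card_insert_of_notMem this.1⟩
        · rw [SimpleGraph.edge_comm] at hT
          have := hT.insert_of_sup_edge (fun h => huv h.symm) hu ht h
          exact ⟨_, this.2, Finset.card_insert_of_notMem this.1⟩
      have := ih hF' T' hT'
      rw [SimpleGraph.isAcyclic_add_edge_iff_of_not_reachable u v huv, this.2]
      omega

/-! ### Geometry of the cells -/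

/-- Barycentric coordinates with respect to the three corners. -/
def bary : Fin 3 → Pt → ℝ
  | 0, x => 1 - x.1 - x.2 / Real.sqrt 3
  | 1, x => x.1 - x.2 / Real.sqrt 3
  | 2, x => 2 * x.2 / Real.sqrt 3

theorem bary_cornerPt (k i : Fin 3) : bary k (cornerPt i) = if k = i then 1 else 0 := by
  have h : Real.sqrt 3 ≠ 0 := by positivity
  fin_cases k <;> fin_cases i <;> simp [bary, cornerPt] <;> field_simp <;> norm_num

theorem bary_psi (k i : Fin 3) (x : Pt) :
    bary k (psi i x) = (bary k x + if k = i then 1 else 0) / 2 := by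
  rw [← bary_cornerPt]
  fin_cases k <;> simp [bary, psi] <;> ring

theorem sum_bary (x : Pt) : bary 0 x + bary 1 x + bary 2 x = 1 := by
  simp only [bary]; ring

theorem eq_of_bary_eq {x y : Pt} (h : ∀ k, bary k x = bary k y) : x = y := by
  have h3 : Real.sqrt 3 ≠ 0 := by positivity
  have h1 := h 1
  have h2 := h 2
  simp only [bary] at h1 h2
  have h2' : x.2 = y.2 := by field_simp at h2; linarith
  rw [h2'] at h1
  exact Prod.ext (by linarith) h2'

theorem cornerPt_injective : Function.Injective cornerPt := fun i j h => by
  have := congrArg (bary i) h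
  simp only [bary_cornerPt, if_true] at this
  by_contra hij
  simp [hij] at this

theorem psi_injective (i : Fin 3) : Function.Injective (psi i) := fun x y h =>
  eq_of_bary_eq fun k => by
    have := congrArg (bary k) h
    simp only [bary_psi] at this
    linarith

theorem psi_cornerPt_comm (i j : Fin 3) : psi i (cornerPt j) = psi j (cornerPt i) := by
  simp only [psi, add_comm]

theorem psi_cornerPt_self (i : Fin 3) : psi i (cornerPt i) = cornerPt i := by
  simp [psi]

theorem mem_sierpV_succ {n : ℕ} {x : Pt} :
    x ∈ sierpV (n + 1) ↔ ∃ i, ∃ u ∈ sierpV n, psi i u = x := by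
  simp [sierpV, Fin.exists_fin_succ]

theorem mem_sierpE_succ {n : ℕ} {e : Sym2 Pt} :
    e ∈ sierpE (n + 1) ↔ ∃ i, ∃ d ∈ sierpE n, Sym2.map (psi i) d = e := by
  simp [sierpE, Fin.exists_fin_succ]

theorem cornerPt_mem_sierpV (n : ℕ) (j : Fin 3) : cornerPt j ∈ sierpV n := by
  induction n with
  | zero => fin_cases j <;> simp [sierpV]
  | succ n ih => exact mem_sierpV_succ.2 ⟨j, _, ih, psi_cornerPt_self j⟩

theorem bary_nonneg {n : ℕ} {x : Pt} (hx : x ∈ sierpV n) (k : Fin 3) : 0 ≤ bary k x := by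
  induction n generalizing x with
  | zero =>
    simp only [sierpV, Finset.mem_insert, Finset.mem_singleton] at hx
    rcases hx with rfl | rfl | rfl <;> rw [bary_cornerPt] <;> split_ifs <;> norm_num
  | succ n ih =>
    obtain ⟨i, u, hu, rfl⟩ := mem_sierpV_succ.1 hx
    have := ih hu
    rw [bary_psi]
    split_ifs <;> linarith

theorem eq_cornerPt_of_one_le_bary {n : ℕ} {x : Pt} (hx : x ∈ sierpV n) {i : Fin 3}
    (h : 1 ≤ bary i x) : x = cornerPt i := by
  have h0 := bary_nonneg hx 0
  have h1 := bary_nonneg hx 1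
  have h2 := bary_nonneg hx 2
  have hs := sum_bary x
  refine eq_of_bary_eq fun k => ?_
  rw [bary_cornerPt]
  fin_cases i <;> fin_cases k <;> simp at h ⊢ <;> linarith

theorem eq_cornerPt_of_psi_eq_psi {n : ℕ} {x y : Pt} (hx : x ∈ sierpV n) (hy : y ∈ sierpV n)
    {i j : Fin 3} (hij : i ≠ j) (h : psi i x = psi j y) : x = cornerPt j ∧ y = cornerPt i := by
  have hi := congrArg (bary i) h
  have hj := congrArg (bary j) h
  simp only [bary_psi, if_true, hij, hij.symm, if_false] at hi hj
  have := bary_nonneg hx i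
  have := bary_nonneg hy j
  exact ⟨eq_cornerPt_of_one_le_bary hx (by linarith), eq_cornerPt_of_one_le_bary hy (by linarith)⟩

theorem card_sierpV_succ (n : ℕ) : (sierpV (n + 1)).card + 3 = 3 * (sierpV n).card := by
  have hinter : ∀ i j : Fin 3, i ≠ j →
      (sierpV n).image (psi i) ∩ (sierpV n).image (psi j) = {psi i (cornerPt j)} := by
    intro i j hij
    ext x
    simp only [Finset.mem_inter, Finset.mem_image, Finset.mem_singleton]
    constructor
    · rintro ⟨⟨a, ha, rfl⟩, b, hb, h⟩
      rw [(eq_cornerPt_of_psi_eq_psi ha hb hij h.symm).1]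
    · rintro rfl
      exact ⟨⟨_, cornerPt_mem_sierpV n j, rfl⟩, _, cornerPt_mem_sierpV n i, psi_cornerPt_comm j i⟩
  have hcard : ∀ i, ((sierpV n).image (psi i)).card = (sierpV n).card :=
    fun i => Finset.card_image_of_injective _ (psi_injective i)
  have h01 := Finset.card_union_add_card_inter ((sierpV n).image (psi 0)) ((sierpV n).image (psi 1))
  have h2 := Finset.card_union_add_card_inter
    ((sierpV n).image (psi 0) ∪ (sierpV n).image (psi 1)) ((sierpV n).image (psi 2))
  have hne : psi 0 (cornerPt 2) ≠ psi 1 (cornerPt 2) := by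
    rw [psi_cornerPt_comm 0, psi_cornerPt_comm 1]
    exact fun h => absurd (cornerPt_injective (psi_injective 2 h)) (by decide)
  rw [hinter 0 1 (by decide), Finset.card_singleton, hcard, hcard] at h01
  rw [Finset.union_inter_distrib_right, hinter 0 2 (by decide), hinter 1 2 (by decide), hcard,
    ← Finset.insert_eq, Finset.card_pair hne] at h2
  simp only [sierpV]
  omega

theorem sierpE_spec {n : ℕ} {e : Sym2 Pt} (he : e ∈ sierpE n) :
    ¬ e.IsDiag ∧ ∀ x ∈ e, x ∈ sierpV n := by
  induction n generalizing e with
  | zero =>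
    have h (i j : Fin 3) (hij : i ≠ j) : ¬ (s(cornerPt i, cornerPt j)).IsDiag ∧
        ∀ x ∈ s(cornerPt i, cornerPt j), x ∈ sierpV 0 := by
      refine ⟨fun h => hij (cornerPt_injective (by simpa using h)), fun x hx => ?_⟩
      rcases Sym2.mem_iff.1 hx with rfl | rfl <;> exact cornerPt_mem_sierpV 0 _
    simp only [sierpE, Finset.mem_insert, Finset.mem_singleton] at he
    rcases he with rfl | rfl | rfl <;> exact h _ _ (by decide)
  | succ n ih =>
    obtain ⟨i, d, hd, rfl⟩ := mem_sierpE_succ.1 he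
    obtain ⟨hd₁, hd₂⟩ := ih hd
    refine ⟨by rwa [Sym2.isDiag_map (psi_injective i)], fun x hx => ?_⟩
    obtain ⟨u, hu, rfl⟩ := Sym2.mem_map.1 hx
    exact mem_sierpV_succ.2 ⟨i, u, hd₂ u hu, rfl⟩

/-! ### Connection patterns of the corners -/

/-- The five partitions of the three corners, each given by the map sending a corner to the least
corner of its block: one block (`0`), corner `i` isolated (`i + 1`), and three blocks (`4`). -/
def cornerRep : Fin 5 → Fin 3 → Fin 3
  | 0 => ![0, 0, 0]
  | 1 => ![0, 1, 1]
  | 2 => ![0, 1, 0]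
  | 3 => ![0, 0, 2]
  | 4 => ![0, 1, 2]

/-- The number of blocks of a partition of the corners. -/
def blockCount (p : Fin 5) : ℕ := (Finset.univ.image (cornerRep p)).card

theorem cornerRep_cornerRep (p : Fin 5) (j : Fin 3) :
    cornerRep p (cornerRep p j) = cornerRep p j := by
  decide +revert

theorem eq_of_cornerRep_iff {p q : Fin 5}
    (h : ∀ j k, cornerRep p j = cornerRep p k ↔ cornerRep q j = cornerRep q k) : p = q := by
  decide +revert

theorem exists_cornerRep_iff {r : Fin 3 → Fin 3 → Prop} (hr : Equivalence r) :
    ∃ p, ∀ j k, r j k ↔ cornerRep p j = cornerRep p k := by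
  have key : ∀ a b c : Bool, (a → b → c) → (b → c → a) → (c → a → b) →
      ∃ p, (a ↔ cornerRep p 0 = cornerRep p 1) ∧ (b ↔ cornerRep p 1 = cornerRep p 2) ∧
        (c ↔ cornerRep p 2 = cornerRep p 0) := by
    decide
  obtain ⟨p, h₁, h₂, h₃⟩ := key (decide (r 0 1)) (decide (r 1 2)) (decide (r 2 0))
    (by simpa using fun h h' => hr.symm (hr.trans h h'))
    (by simpa using fun h h' => hr.symm (hr.trans h h'))
    (by simpa using fun h h' => hr.symm (hr.trans h h'))
  simp only [decide_eq_true_eq] at h₁ h₂ h₃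
  have hsymm : ∀ j k, r j k ↔ r k j := fun j k => ⟨hr.symm, hr.symm⟩
  refine ⟨p, fun j k => ?_⟩
  fin_cases j <;> fin_cases k <;>
    simp [hr.refl, h₁, h₂, h₃, hsymm 1 0, hsymm 2 1, hsymm 0 2,
      eq_comm (a := cornerRep p 1) (b := cornerRep p 0),
      eq_comm (a := cornerRep p 2) (b := cornerRep p 1),
      eq_comm (a := cornerRep p 0) (b := cornerRep p 2)]

/-- The corners are connected in `F` according to the pattern `p`. -/
def HasPattern (F : Finset (Sym2 Pt)) (p : Fin 5) : Prop :=
  ∀ j k, (graphOf F).Reachable (cornerPt j) (cornerPt k) ↔ cornerRep p j = cornerRep p k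

/-- Every vertex of `G_n` is connected to a corner in `F`. -/
def CornerSpanning (n : ℕ) (F : Finset (Sym2 Pt)) : Prop :=
  ∀ x ∈ sierpV n, ∃ j, (graphOf F).Reachable (cornerPt j) x

theorem exists_hasPattern (F : Finset (Sym2 Pt)) : ∃ p, HasPattern F p :=
  exists_cornerRep_iff ⟨fun _ => .rfl, .symm, .trans⟩

theorem HasPattern.unique {F : Finset (Sym2 Pt)} {p q : Fin 5} (hp : HasPattern F p)
    (hq : HasPattern F q) : p = q :=
  eq_of_cornerRep_iff fun j k => (hp j k).symm.trans (hq j k)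

theorem HasPattern.card_le_and_isAcyclic_iff {n : ℕ} {F : Finset (Sym2 Pt)} {p : Fin 5}
    (hF : F ⊆ sierpE n) (hp : HasPattern F p) (hs : CornerSpanning n F) :
    (sierpV n).card ≤ F.card + blockCount p ∧
      ((graphOf F).IsAcyclic ↔ F.card + blockCount p = (sierpV n).card) := by
  have hcard : ((Finset.univ.image (cornerRep p)).image cornerPt).card = blockCount p :=
    Finset.card_image_of_injective _ cornerPt_injective
  rw [← hcard]
  refine IsTransversal.card_le_and_isAcyclic_iff _ F (fun e he => sierpE_spec (hF he)) _
    ⟨?_, fun x hx => ?_, ?_⟩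
  · intro x hx
    obtain ⟨j, -, rfl⟩ := Finset.mem_image.1 hx
    exact cornerPt_mem_sierpV n j
  · obtain ⟨j, hj⟩ := hs x hx
    exact ⟨cornerPt (cornerRep p j), by simp,
      ((hp _ _).2 (cornerRep_cornerRep p j)).trans hj⟩
  · simp only [Finset.mem_image, Finset.mem_univ, true_and, forall_exists_index, and_imp,
      forall_apply_eq_imp_iff]
    intro i j h
    have := (hp _ _).1 h
    simp only [cornerRep_cornerRep] at this
    rw [this]

/-- The spanning forests of `G_n` all of whose components meet the corners, with the corners
connected according to the pattern `p`. -/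
def patternForests (n : ℕ) (p : Fin 5) : Finset (Finset (Sym2 Pt)) :=
  (sierpE n).powerset.filter fun F =>
    (graphOf F).IsAcyclic ∧ HasPattern F p ∧ CornerSpanning n F

theorem mem_patternForests {n : ℕ} {p : Fin 5} {F : Finset (Sym2 Pt)} :
    F ∈ patternForests n p ↔
      F ⊆ sierpE n ∧ (graphOf F).IsAcyclic ∧ HasPattern F p ∧ CornerSpanning n F := by
  simp [patternForests]

theorem mem_patternForests_iff_card {n : ℕ} {p : Fin 5} {F : Finset (Sym2 Pt)} :
    F ∈ patternForests n p ↔ F ⊆ sierpE n ∧ HasPattern F p ∧ CornerSpanning n F ∧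
      F.card + blockCount p = (sierpV n).card := by
  rw [mem_patternForests]
  constructor
  · rintro ⟨h₁, h₂, h₃, h₄⟩
    exact ⟨h₁, h₃, h₄, (h₃.card_le_and_isAcyclic_iff h₁ h₄).2.1 h₂⟩
  · rintro ⟨h₁, h₂, h₃, h₄⟩
    exact ⟨h₁, (h₂.card_le_and_isAcyclic_iff h₁ h₃).2.2 h₄, h₂, h₃⟩

theorem treeSet_eq_patternForests (n : ℕ) : treeSet n = patternForests n 0 := by
  ext F
  simp only [treeSet, patternForests, Finset.mem_filter]
  have hrep : ∀ j k, cornerRep 0 j = cornerRep 0 k := by decide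
  refine and_congr_right fun _ => and_congr_right fun _ => ⟨fun h => ⟨fun j k => ?_, ?_⟩, ?_⟩
  · exact iff_of_true (h _ (cornerPt_mem_sierpV n j) _ (cornerPt_mem_sierpV n k)) (hrep j k)
  · exact fun x hx => ⟨0, h _ (cornerPt_mem_sierpV n 0) _ hx⟩
  · rintro ⟨hp, hs⟩ x hx y hy
    obtain ⟨j, hj⟩ := hs x hx
    obtain ⟨k, hk⟩ := hs y hy
    exact (hj.symm.trans ((hp j k).2 (hrep j k))).trans hk

theorem threeForestSet_eq_patternForests (n : ℕ) : threeForestSet n = patternForests n 4 := by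
  ext F
  simp only [threeForestSet, patternForests, Finset.mem_filter]
  refine and_congr_right fun _ => and_congr_right fun _ => and_congr_left fun _ => ?_
  have hrep : ∀ j k, cornerRep 4 j = cornerRep 4 k ↔ j = k := by decide
  simp only [HasPattern, hrep]
  refine ⟨fun h j k => ⟨fun hjk => ?_, fun hjk => hjk ▸ .rfl⟩, fun h j k hjk hr => ?_⟩
  · by_contra hne
    exact h j k hne hjk
  · exact hjk ((h j k).1 hr)

theorem twoForestSet_eq_patternForests (n : ℕ) : twoForestSet n 0 = patternForests n 1 := by
  ext F
  simp only [twoForestSet, patternForests, Finset.mem_filter, ← and_assoc]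
  refine and_congr_left fun _ => ?_
  simp only [and_assoc]
  refine and_congr_right fun _ => and_congr_right fun _ => ?_
  have hrep : ∀ j k, cornerRep 1 j = cornerRep 1 k ↔ (j = 0 ↔ k = 0) := by decide
  simp only [HasPattern, hrep]
  constructor
  · rintro ⟨h₁, h₂⟩ j k
    by_cases hj : j = 0 <;> by_cases hk : k = 0
    · subst hj hk
      simp
    · subst hj
      simpa [hk] using h₁ k hk
    · subst hk
      simpa [hj] using fun h : (graphOf F).Reachable _ _ => h₁ j hj h.symm
    · simpa [hj, hk] using h₂ j k hj hk
  · exact fun h => ⟨fun j hj hr => hj (((h 0 j).1 hr).1 rfl),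
      fun j k hj hk => (h j k).2 (iff_of_false hj hk)⟩

/-! ### Gluing three cells -/

/-- The edge set in `G_{n+1}` whose part in the cell `i` is the image of `g i`. -/
def cellJoin (g : Fin 3 → Finset (Sym2 Pt)) : Finset (Sym2 Pt) :=
  Finset.univ.biUnion fun i => (g i).image (Sym2.map (psi i))

theorem mem_cellJoin {g : Fin 3 → Finset (Sym2 Pt)} {e : Sym2 Pt} :
    e ∈ cellJoin g ↔ ∃ i, ∃ d ∈ g i, Sym2.map (psi i) d = e := by
  simp [cellJoin]

theorem eq_and_eq_of_map_psi_eq {n : ℕ} {i j : Fin 3} {d e : Sym2 Pt} (hd : d ∈ sierpE n)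
    (he : e ∈ sierpE n) (h : Sym2.map (psi i) d = Sym2.map (psi j) e) : i = j ∧ d = e := by
  have hij : i = j := by
    by_contra hij
    obtain ⟨hdiag, hdV⟩ := sierpE_spec hd
    refine hdiag ?_
    induction d with | _ x y
    have key : ∀ z ∈ s(x, y), z = cornerPt j := fun z hz => by
      have : psi i z ∈ Sym2.map (psi j) e := h ▸ Sym2.mem_map.2 ⟨z, hz, rfl⟩
      obtain ⟨w, hw, hwz⟩ := Sym2.mem_map.1 this
      exact (eq_cornerPt_of_psi_eq_psi (hdV z hz) ((sierpE_spec he).2 w hw) hij hwz.symm).1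
    simp [key x, key y]
  subst hij
  exact ⟨rfl, Sym2.map.injective (psi_injective i) h⟩

theorem cellJoin_subset {n : ℕ} {g : Fin 3 → Finset (Sym2 Pt)} (hg : ∀ i, g i ⊆ sierpE n) :
    cellJoin g ⊆ sierpE (n + 1) := fun e he => by
  obtain ⟨i, d, hd, rfl⟩ := mem_cellJoin.1 he
  exact mem_sierpE_succ.2 ⟨i, d, hg i hd, rfl⟩

theorem exists_cellJoin_eq {n : ℕ} {F : Finset (Sym2 Pt)} (hF : F ⊆ sierpE (n + 1)) :
    ∃ g : Fin 3 → Finset (Sym2 Pt), (∀ i, g i ⊆ sierpE n) ∧ cellJoin g = F := by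
  refine ⟨fun i => (sierpE n).filter fun e => Sym2.map (psi i) e ∈ F,
    fun i => Finset.filter_subset _ _, ?_⟩
  ext e
  simp only [mem_cellJoin, Finset.mem_filter]
  constructor
  · rintro ⟨i, d, ⟨-, h⟩, rfl⟩
    exact h
  · intro he
    obtain ⟨i, d, hd, rfl⟩ := mem_sierpE_succ.1 (hF he)
    exact ⟨i, d, ⟨hd, he⟩, rfl⟩

theorem cellJoin_injOn {n : ℕ} {g g' : Fin 3 → Finset (Sym2 Pt)} (hg : ∀ i, g i ⊆ sierpE n)
    (hg' : ∀ i, g' i ⊆ sierpE n) (h : cellJoin g = cellJoin g') : g = g' := by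
  have key : ∀ {f f' : Fin 3 → Finset (Sym2 Pt)}, (∀ i, f i ⊆ sierpE n) →
      (∀ i, f' i ⊆ sierpE n) → cellJoin f = cellJoin f' → ∀ i, f i ⊆ f' i := by
    intro f f' hf hf' h i e he
    have : Sym2.map (psi i) e ∈ cellJoin f' := h ▸ mem_cellJoin.2 ⟨i, e, he, rfl⟩
    obtain ⟨j, d, hd, hde⟩ := mem_cellJoin.1 this
    obtain ⟨rfl, rfl⟩ := eq_and_eq_of_map_psi_eq (hf' j hd) (hf i he) hde
    exact hd
  exact funext fun i => (key hg hg' h i).antisymm (key hg' hg h.symm i)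

theorem card_cellJoin {n : ℕ} {g : Fin 3 → Finset (Sym2 Pt)} (hg : ∀ i, g i ⊆ sierpE n) :
    (cellJoin g).card = ∑ i, (g i).card := by
  rw [cellJoin, Finset.card_biUnion]
  · exact Finset.sum_congr rfl fun i _ =>
      Finset.card_image_of_injective _ (Sym2.map.injective (psi_injective i))
  · intro i _ j _ hij
    rw [Function.onFun, Finset.disjoint_left]
    intro e hi hj
    obtain ⟨d, hd, rfl⟩ := Finset.mem_image.1 hi
    obtain ⟨d', hd', h⟩ := Finset.mem_image.1 hj
    exact hij (eq_and_eq_of_map_psi_eq (hg i hd) (hg j hd') h.symm).1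

theorem graphOf_adj {F : Finset (Sym2 Pt)} {x y : Pt} :
    (graphOf F).Adj x y ↔ s(x, y) ∈ F ∧ x ≠ y := by
  simp [graphOf]

/-- The inclusion of the cell `i` into a glued graph. -/
def cellHom (g : Fin 3 → Finset (Sym2 Pt)) (i : Fin 3) :
    graphOf (g i) →g graphOf (cellJoin g) where
  toFun := psi i
  map_rel' h := by
    rw [graphOf_adj] at h ⊢
    exact ⟨mem_cellJoin.2 ⟨i, _, h.1, rfl⟩, (psi_injective i).ne h.2⟩

theorem reachable_cellJoin {g : Fin 3 → Finset (Sym2 Pt)} {i : Fin 3} {u v : Pt}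
    (h : (graphOf (g i)).Reachable u v) :
    (graphOf (cellJoin g)).Reachable (psi i u) (psi i v) :=
  h.map (cellHom g i)

theorem exists_adj_of_cellJoin_adj {g : Fin 3 → Finset (Sym2 Pt)} {x y : Pt}
    (h : (graphOf (cellJoin g)).Adj x y) :
    ∃ i u v, (graphOf (g i)).Adj u v ∧ psi i u = x ∧ psi i v = y := by
  rw [graphOf_adj] at h
  obtain ⟨i, d, hd, hde⟩ := mem_cellJoin.1 h.1
  induction d with | _ u v
  rw [Sym2.map_mk, Sym2.eq_iff] at hde
  rcases hde with ⟨rfl, rfl⟩ | ⟨rfl, rfl⟩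
  · exact ⟨i, u, v, graphOf_adj.2 ⟨hd, fun h' => h.2 (h' ▸ rfl)⟩, rfl, rfl⟩
  · exact ⟨i, v, u, graphOf_adj.2 ⟨Sym2.eq_swap ▸ hd, fun h' => h.2 (h' ▸ rfl)⟩, rfl, rfl⟩

/-- Identify the labels of `a` and `b` in the labelling `f`. -/
def mergeLabel {α β : Type*} [DecidableEq β] (f : α → β) (a b : α) (x : α) : β :=
  if f x = f b then f a else f x

theorem mergeLabel_eq {α β : Type*} [DecidableEq β] (f : α → β) (a b : α) :
    mergeLabel f a b a = mergeLabel f a b b := by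
  simp [mergeLabel]

theorem mergeLabel_congr {α β : Type*} [DecidableEq β] {f : α → β} (a b : α) {x y : α}
    (h : f x = f y) : mergeLabel f a b x = mergeLabel f a b y := by
  simp [mergeLabel, h]

theorem rel_of_mergeLabel_eq {α β : Type*} [DecidableEq β] {f : α → β} {a b : α}
    {r : α → α → Prop} (hr : Equivalence r) (hf : ∀ x y, f x = f y → r x y) (hab : r a b)
    (x y : α) (h : mergeLabel f a b x = mergeLabel f a b y) : r x y := by
  unfold mergeLabel at h
  split_ifs at h with hx hy hy
  · exact hr.trans (hf _ _ hx) (hr.symm (hf _ _ hy))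
  · exact hr.trans (hf _ _ hx) (hr.trans (hr.symm hab) (hf _ _ h))
  · exact hr.trans (hf _ _ h) (hr.trans hab (hr.symm (hf _ _ hy)))
  · exact hf _ _ h

/-- The labelling of the pairs `(i, j)`, standing for corner `j` of cell `i`, in which exactly
`(i, j)` and `(j, i)` share a label. -/
def junctionLabel (x : Fin 3 × Fin 3) : Fin 3 × Fin 3 := (min x.1 x.2, max x.1 x.2)

/-- Identify the labels of the corners of the cell `i` according to the pattern `p`. -/
def mergeCell (p : Fin 5) (i : Fin 3) (f : Fin 3 × Fin 3 → Fin 3 × Fin 3) :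
    Fin 3 × Fin 3 → Fin 3 × Fin 3 :=
  mergeLabel (mergeLabel f (i, cornerRep p 1) (i, 1)) (i, cornerRep p 2) (i, 2)

/-- The labelling of the corners of the cells by the components of the graph obtained by gluing
cells with patterns `p`. -/
def glueLabel (p : Fin 3 → Fin 5) : Fin 3 × Fin 3 → Fin 3 × Fin 3 :=
  mergeCell (p 2) 2 (mergeCell (p 1) 1 (mergeCell (p 0) 0 junctionLabel))

theorem mergeCell_congr (p : Fin 5) (i : Fin 3) {f : Fin 3 × Fin 3 → Fin 3 × Fin 3}
    {x y : Fin 3 × Fin 3} (h : f x = f y) : mergeCell p i f x = mergeCell p i f y :=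
  mergeLabel_congr _ _ (mergeLabel_congr _ _ h)

theorem mergeCell_eq (p : Fin 5) (i j k : Fin 3) (f : Fin 3 × Fin 3 → Fin 3 × Fin 3)
    (h : cornerRep p j = cornerRep p k) : mergeCell p i f (i, j) = mergeCell p i f (i, k) := by
  have key : ∀ j, mergeCell p i f (i, cornerRep p j) = mergeCell p i f (i, j) := by
    intro j
    fin_cases j
    · have : cornerRep p 0 = 0 := by decide +revert
      simp [this]
    · exact mergeLabel_congr _ _ (mergeLabel_eq _ _ _)
    · exact mergeLabel_eq _ _ _
  rw [← key j, ← key k, h]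

theorem glueLabel_swap (p : Fin 3 → Fin 5) (i j : Fin 3) :
    glueLabel p (i, j) = glueLabel p (j, i) :=
  mergeCell_congr _ _ (mergeCell_congr _ _ (mergeCell_congr _ _
    (by simp [junctionLabel, min_comm, max_comm])))

theorem glueLabel_eq (p : Fin 3 → Fin 5) (i j k : Fin 3)
    (h : cornerRep (p i) j = cornerRep (p i) k) : glueLabel p (i, j) = glueLabel p (i, k) := by
  fin_cases i
  · exact mergeCell_congr _ _ (mergeCell_congr _ _ (mergeCell_eq _ _ _ _ _ h))
  · exact mergeCell_congr _ _ (mergeCell_eq _ _ _ _ _ h)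
  · exact mergeCell_eq _ _ _ _ _ h

theorem rel_of_glueLabel_eq {p : Fin 3 → Fin 5} {r : Fin 3 × Fin 3 → Fin 3 × Fin 3 → Prop}
    (hr : Equivalence r) (hswap : ∀ i j, r (i, j) (j, i))
    (hcell : ∀ i j k, cornerRep (p i) j = cornerRep (p i) k → r (i, j) (i, k))
    {x y : Fin 3 × Fin 3} (h : glueLabel p x = glueLabel p y) : r x y := by
  have hj : ∀ x y, junctionLabel x = junctionLabel y → r x y := by
    have : ∀ x y, junctionLabel x = junctionLabel y → x = y ∨ y = (x.2, x.1) := by decide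
    intro x y h
    rcases this x y h with rfl | rfl
    · exact hr.refl _
    · exact hswap _ _
  have hm : ∀ i f, (∀ x y, f x = f y → r x y) →
      ∀ x y, mergeCell (p i) i f x = mergeCell (p i) i f y → r x y := fun i f hf =>
    rel_of_mergeLabel_eq hr (rel_of_mergeLabel_eq hr hf
      (hcell i _ _ (cornerRep_cornerRep _ _))) (hcell i _ _ (cornerRep_cornerRep _ _))
  exact hm 2 _ (hm 1 _ (hm 0 _ hj)) x y h

theorem exists_reachable_of_cellJoin_reachable {n : ℕ} {g : Fin 3 → Finset (Sym2 Pt)}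
    {p : Fin 3 → Fin 5} (hg : ∀ i, g i ⊆ sierpE n) (hp : ∀ i, HasPattern (g i) (p i))
    (s : Fin 3 × Fin 3) {y : Pt}
    (h : (graphOf (cellJoin g)).Reachable (psi s.1 (cornerPt s.2)) y) :
    ∃ i j u, glueLabel p (i, j) = glueLabel p s ∧ u ∈ sierpV n ∧ psi i u = y ∧
      (graphOf (g i)).Reachable (cornerPt j) u := by
  rw [SimpleGraph.reachable_iff_reflTransGen] at h
  induction h with
  | refl => exact ⟨s.1, s.2, _, rfl, cornerPt_mem_sierpV n _, rfl, .rfl⟩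
  | @tail y z _ hyz ih =>
    obtain ⟨i, j, u, hl, hu, rfl, hr⟩ := ih
    obtain ⟨k, u', v, hadj, huu', rfl⟩ := exists_adj_of_cellJoin_adj hyz
    have he := (sierpE_spec (hg k (graphOf_adj.1 hadj).1)).2
    have hu' : u' ∈ sierpV n := he u' (by simp)
    have hv : v ∈ sierpV n := he v (by simp)
    by_cases hki : k = i
    · subst hki
      obtain rfl := psi_injective k huu'
      exact ⟨k, j, v, hl, hv, rfl, hr.trans hadj.reachable⟩
    · obtain ⟨rfl, rfl⟩ := eq_cornerPt_of_psi_eq_psi hu' hu hki huu'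
      refine ⟨k, i, v, ?_, hv, rfl, hadj.reachable⟩
      rw [← hl, glueLabel_swap]
      exact (glueLabel_eq p i j k ((hp i j k).1 hr)).symm

theorem cellJoin_reachable_iff {n : ℕ} {g : Fin 3 → Finset (Sym2 Pt)} {p : Fin 3 → Fin 5}
    (hg : ∀ i, g i ⊆ sierpE n) (hp : ∀ i, HasPattern (g i) (p i)) (s t : Fin 3 × Fin 3) :
    (graphOf (cellJoin g)).Reachable (psi s.1 (cornerPt s.2)) (psi t.1 (cornerPt t.2)) ↔
      glueLabel p s = glueLabel p t := by
  constructor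
  · intro h
    obtain ⟨i, j, u, hl, hu, hut, hr⟩ := exists_reachable_of_cellJoin_reachable hg hp s h
    obtain ⟨a, b⟩ := t
    rw [← hl]
    by_cases hia : i = a
    · subst hia
      obtain rfl := psi_injective i hut
      exact glueLabel_eq p i j b ((hp i j b).1 hr)
    · obtain ⟨rfl, hb⟩ := eq_cornerPt_of_psi_eq_psi hu (cornerPt_mem_sierpV n b) hia hut
      obtain rfl := cornerPt_injective hb
      rw [glueLabel_swap p a b]
      exact glueLabel_eq p b j a ((hp b j a).1 hr)
  · refine rel_of_glueLabel_eq (r := fun s t => (graphOf (cellJoin g)).Reachable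
      (psi s.1 (cornerPt s.2)) (psi t.1 (cornerPt t.2))) ⟨fun _ => .rfl, .symm, .trans⟩ ?_ ?_
    · intro i j
      rw [psi_cornerPt_comm]
    · exact fun i j k h => reachable_cellJoin ((hp i j k).2 h)

/-- Gluing forests with patterns `p` produces a forest with pattern `q`. -/
def Glues (p : Fin 3 → Fin 5) (q : Fin 5) : Prop :=
  (∀ j k, glueLabel p (j, j) = glueLabel p (k, k) ↔ cornerRep q j = cornerRep q k) ∧
  (∀ x, ∃ j, glueLabel p x = glueLabel p (j, j)) ∧
  blockCount q + 3 = blockCount (p 0) + blockCount (p 1) + blockCount (p 2)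

instance (p : Fin 3 → Fin 5) (q : Fin 5) : Decidable (Glues p q) :=
  inferInstanceAs (Decidable (_ ∧ _ ∧ _))

theorem cellJoin_hasPattern_iff {n : ℕ} {g : Fin 3 → Finset (Sym2 Pt)} {p : Fin 3 → Fin 5}
    {q : Fin 5} (hg : ∀ i, g i ⊆ sierpE n) (hp : ∀ i, HasPattern (g i) (p i)) :
    HasPattern (cellJoin g) q ↔
      ∀ j k, glueLabel p (j, j) = glueLabel p (k, k) ↔ cornerRep q j = cornerRep q k := by
  refine forall₂_congr fun j k => ?_
  rw [← cellJoin_reachable_iff hg hp (j, j) (k, k)]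
  simp only [psi_cornerPt_self]

theorem cellJoin_cornerSpanning_iff {n : ℕ} {g : Fin 3 → Finset (Sym2 Pt)} {p : Fin 3 → Fin 5}
    (hg : ∀ i, g i ⊆ sierpE n) (hp : ∀ i, HasPattern (g i) (p i)) :
    CornerSpanning (n + 1) (cellJoin g) ↔
      (∀ i, CornerSpanning n (g i)) ∧ ∀ x, ∃ j, glueLabel p x = glueLabel p (j, j) := by
  constructor
  · refine fun h => ⟨fun i x hx => ?_, fun x => ?_⟩
    · obtain ⟨j, hj⟩ := h _ (mem_sierpV_succ.2 ⟨i, x, hx, rfl⟩)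
      rw [← psi_cornerPt_self j] at hj
      obtain ⟨i', k, u, -, hu, hux, hr⟩ := exists_reachable_of_cellJoin_reachable hg hp (j, j) hj
      by_cases hii : i' = i
      · subst hii
        obtain rfl := psi_injective _ hux
        exact ⟨k, hr⟩
      · exact ⟨i', (eq_cornerPt_of_psi_eq_psi hu hx hii hux).2 ▸ .rfl⟩
    · obtain ⟨j, hj⟩ := h _ (mem_sierpV_succ.2 ⟨x.1, _, cornerPt_mem_sierpV n x.2, rfl⟩)
      rw [← psi_cornerPt_self j] at hj
      exact ⟨j, ((cellJoin_reachable_iff hg hp (j, j) x).1 hj).symm⟩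
  · rintro ⟨hs, hl⟩ x hx
    obtain ⟨i, u, hu, rfl⟩ := mem_sierpV_succ.1 hx
    obtain ⟨k, hk⟩ := hs i u hu
    obtain ⟨j, hj⟩ := hl (i, k)
    refine ⟨j, ?_⟩
    have := (cellJoin_reachable_iff hg hp (j, j) (i, k)).2 hj.symm
    rw [psi_cornerPt_self] at this
    exact this.trans (reachable_cellJoin hk)

theorem cellJoin_mem_patternForests_iff {n : ℕ} {g : Fin 3 → Finset (Sym2 Pt)} {q : Fin 5}
    (hg : ∀ i, g i ⊆ sierpE n) :
    cellJoin g ∈ patternForests (n + 1) q ↔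
      ∃ p, Glues p q ∧ ∀ i, g i ∈ patternForests n (p i) := by
  have hV := card_sierpV_succ n
  have hE := card_cellJoin hg
  rw [Fin.sum_univ_three] at hE
  constructor
  · intro h
    choose p hp using fun i => exists_hasPattern (g i)
    have h' := mem_patternForests_iff_card.1 h
    rw [cellJoin_hasPattern_iff hg hp, cellJoin_cornerSpanning_iff hg hp] at h'
    obtain ⟨-, h₁, ⟨h₂, h₃⟩, h₄⟩ := h'
    have hmem : ∀ i, g i ∈ patternForests n (p i) := fun i => mem_patternForests.2
      ⟨hg i, (mem_patternForests.1 h).2.1.comap (cellHom g i) (psi_injective i), hp i, h₂ i⟩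
    have hcard := fun i => (mem_patternForests_iff_card.1 (hmem i)).2.2.2
    have := hcard 0
    have := hcard 1
    have := hcard 2
    exact ⟨p, ⟨h₁, h₃, by omega⟩, hmem⟩
  · rintro ⟨p, ⟨h₁, h₂, h₃⟩, h⟩
    simp only [mem_patternForests_iff_card] at h ⊢
    have hp := fun i => (h i).2.1
    have := (h 0).2.2.2
    have := (h 1).2.2.2
    have := (h 2).2.2.2
    exact ⟨cellJoin_subset hg, (cellJoin_hasPattern_iff hg hp).2 h₁,
      (cellJoin_cornerSpanning_iff hg hp).2 ⟨fun i => (h i).2.2.1, h₂⟩, by omega⟩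

theorem card_patternForests_succ (n : ℕ) (q : Fin 5) :
    (patternForests (n + 1) q).card =
      ∑ p with Glues p q, ∏ i, (patternForests n (p i)).card := by
  have hsub {p : Fin 3 → Fin 5} {g : Fin 3 → Finset (Sym2 Pt)}
      (h : g ∈ Fintype.piFinset fun i => patternForests n (p i)) (i : Fin 3) :
      g i ⊆ sierpE n := (mem_patternForests.1 (Fintype.mem_piFinset.1 h i)).1
  have hunion : patternForests (n + 1) q = (Finset.univ.filter (Glues · q)).biUnion fun p =>
      (Fintype.piFinset fun i => patternForests n (p i)).image cellJoin := by
    ext F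
    simp only [Finset.mem_biUnion, Finset.mem_filter, Finset.mem_univ, true_and, Finset.mem_image]
    constructor
    · intro h
      obtain ⟨g, hg, rfl⟩ := exists_cellJoin_eq (mem_patternForests.1 h).1
      obtain ⟨p, hpq, hp⟩ := (cellJoin_mem_patternForests_iff hg).1 h
      exact ⟨p, hpq, g, Fintype.mem_piFinset.2 hp, rfl⟩
    · rintro ⟨p, hpq, g, hp, rfl⟩
      exact (cellJoin_mem_patternForests_iff (hsub hp)).2 ⟨p, hpq, Fintype.mem_piFinset.1 hp⟩
  rw [hunion, Finset.card_biUnion]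
  · refine Finset.sum_congr rfl fun p _ => ?_
    rw [Finset.card_image_of_injOn fun g hg g' hg' h =>
      cellJoin_injOn (hsub hg) (hsub hg') h, Fintype.card_piFinset]
  · intro p _ p' _ hne
    rw [Function.onFun, Finset.disjoint_left]
    intro F hF hF'
    obtain ⟨g, hg, rfl⟩ := Finset.mem_image.1 hF
    obtain ⟨g', hg', h⟩ := Finset.mem_image.1 hF'
    obtain rfl := cellJoin_injOn (hsub hg') (hsub hg) h
    refine hne (funext fun i => ?_)
    exact (mem_patternForests.1 (Fintype.mem_piFinset.1 hg i)).2.2.1.unique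
      (mem_patternForests.1 (Fintype.mem_piFinset.1 hg' i)).2.2.1

/-! ### The triangle `G_0` and the recursion -/

/-- The edge of `G_0` opposite to the corner `k`. -/
def oppositeEdge (k : Fin 3) : Sym2 Pt := s(cornerPt (k + 1), cornerPt (k + 2))

theorem oppositeEdge_injective : Function.Injective oppositeEdge := by
  have key : ∀ i j : Fin 3, s(i + 1, i + 2) = s(j + 1, j + 2) → i = j := by decide
  exact fun i j h => key i j (Sym2.map.injective cornerPt_injective h)

theorem sierpE_zero : sierpE 0 = Finset.univ.image oppositeEdge := by
  have h : (Finset.univ : Finset (Fin 3)) = {2, 0, 1} := by decide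
  rw [h]
  simp [sierpE, oppositeEdge]

/-- The pattern of the subgraph of `G_0` consisting of the edges opposite to the corners in `D`. -/
def trianglePattern (D : Finset (Fin 3)) : Fin 5 :=
  if 2 ≤ D.card then 0 else if 0 ∈ D then 1 else if 1 ∈ D then 2 else if 2 ∈ D then 3 else 4

theorem cornerRep_trianglePattern : ∀ (D : Finset (Fin 3)), ∀ l ∈ D,
    cornerRep (trianglePattern D) (l + 1) = cornerRep (trianglePattern D) (l + 2) := by
  decide

theorem hasPattern_trianglePattern (D : Finset (Fin 3)) :
    HasPattern (D.image oppositeEdge) (trianglePattern D) := by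
  have hadj : ∀ j k, (∃ l ∈ D, s(j, k) = s(l + 1, l + 2)) →
      (graphOf (D.image oppositeEdge)).Reachable (cornerPt j) (cornerPt k) := by
    rintro j k ⟨l, hl, h⟩
    by_cases hjk : j = k
    · exact hjk ▸ .rfl
    refine SimpleGraph.Adj.reachable (graphOf_adj.2 ⟨?_, cornerPt_injective.ne hjk⟩)
    exact Finset.mem_image.2 ⟨l, hl, congrArg (Sym2.map cornerPt) h.symm⟩
  intro j k
  constructor
  · intro h
    have key : ∀ y, (graphOf (D.image oppositeEdge)).Reachable (cornerPt j) y → ∃ i,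
        cornerPt i = y ∧ cornerRep (trianglePattern D) j = cornerRep (trianglePattern D) i := by
      intro y h
      rw [SimpleGraph.reachable_iff_reflTransGen] at h
      induction h with
      | refl => exact ⟨j, rfl, rfl⟩
      | tail _ hyz ih =>
        obtain ⟨i, rfl, hi⟩ := ih
        obtain ⟨l, hl, h⟩ := Finset.mem_image.1 (graphOf_adj.1 hyz).1
        have hl' : cornerRep (trianglePattern D) (l + 1) =
            cornerRep (trianglePattern D) (l + 2) := cornerRep_trianglePattern D l hl
        rw [oppositeEdge, Sym2.eq_iff] at h
        rcases h with ⟨h, rfl⟩ | ⟨rfl, h⟩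
        · obtain rfl := cornerPt_injective h
          exact ⟨_, rfl, hi.trans hl'⟩
        · obtain rfl := cornerPt_injective h
          exact ⟨_, rfl, hi.trans hl'.symm⟩
    obtain ⟨i, hi, h⟩ := key _ h
    rwa [← cornerPt_injective hi]
  · have key : ∀ (D : Finset (Fin 3)) (j k : Fin 3),
        cornerRep (trianglePattern D) j = cornerRep (trianglePattern D) k → j = k ∨ ∃ i,
          (∃ l ∈ D, s(j, i) = s(l + 1, l + 2)) ∧
            (i = k ∨ ∃ l ∈ D, s(i, k) = s(l + 1, l + 2)) := by
      decide
    intro h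
    rcases key D j k h with rfl | ⟨i, h₁, rfl | h₂⟩
    · exact .rfl
    · exact hadj _ _ h₁
    · exact (hadj _ _ h₁).trans (hadj _ _ h₂)

theorem card_patternForests_zero (p : Fin 5) :
    (patternForests 0 p).card = if p = 0 then 3 else 1 := by
  have hV : sierpV 0 = Finset.univ.image cornerPt := by
    have h : (Finset.univ : Finset (Fin 3)) = {0, 1, 2} := by decide
    rw [h]
    simp [sierpV]
  have hVcard : (sierpV 0).card = 3 := by
    rw [hV, Finset.card_image_of_injective _ cornerPt_injective]
    simp
  have key : patternForests 0 p =
      (Finset.univ.filter fun D => trianglePattern D = p ∧ D.card + blockCount p = 3).image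
        (Finset.image oppositeEdge) := by
    ext F
    simp only [mem_patternForests_iff_card, hVcard, Finset.mem_image, Finset.mem_filter,
      Finset.mem_univ, true_and]
    constructor
    · rintro ⟨hF, hp, -, hcard⟩
      rw [sierpE_zero, Finset.subset_image_iff] at hF
      obtain ⟨D, -, rfl⟩ := hF
      rw [Finset.card_image_of_injective _ oppositeEdge_injective] at hcard
      exact ⟨D, ⟨(hasPattern_trianglePattern D).unique hp, hcard⟩, rfl⟩
    · rintro ⟨D, ⟨rfl, hcard⟩, rfl⟩
      refine ⟨?_, hasPattern_trianglePattern D, fun x hx => ?_, ?_⟩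
      · rw [sierpE_zero]
        exact Finset.image_subset_image (Finset.subset_univ _)
      · rw [hV] at hx
        obtain ⟨j, -, rfl⟩ := Finset.mem_image.1 hx
        exact ⟨j, .rfl⟩
      · rwa [Finset.card_image_of_injective _ oppositeEdge_injective]
  rw [key, Finset.card_image_of_injective _ (Finset.image_injective oppositeEdge_injective)]
  clear key hV hVcard
  decide +revert

set_option maxRecDepth 100000 in
theorem filter_glues_val :
    (Finset.univ.filter (Glues · 0)).val =
      {![0, 0, 1], ![0, 0, 2], ![0, 1, 0], ![0, 3, 0], ![2, 0, 0], ![3, 0, 0]} ∧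
    (Finset.univ.filter (Glues · 1)).val =
      {![0, 1, 1], ![1, 0, 1], ![1, 0, 2], ![1, 1, 0], ![1, 3, 0], ![2, 0, 1], ![3, 1, 0],
        ![4, 0, 0]} ∧
    (Finset.univ.filter (Glues · 2)).val =
      {![0, 1, 2], ![0, 2, 1], ![0, 2, 2], ![0, 4, 0], ![2, 0, 2], ![2, 2, 0], ![2, 3, 0],
        ![3, 2, 0]} ∧
    (Finset.univ.filter (Glues · 3)).val =
      {![0, 0, 4], ![0, 1, 3], ![0, 3, 1], ![0, 3, 3], ![2, 0, 3], ![3, 0, 2], ![3, 0, 3],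
        ![3, 3, 0]} ∧
    (Finset.univ.filter (Glues · 4)).val =
      {![0, 1, 4], ![0, 2, 4], ![0, 4, 1], ![0, 4, 3], ![1, 0, 4], ![1, 1, 2], ![1, 1, 3],
        ![1, 2, 1], ![1, 2, 2], ![1, 3, 1], ![1, 3, 3], ![1, 4, 0], ![2, 0, 4], ![2, 2, 1],
        ![2, 2, 3], ![2, 3, 1], ![2, 3, 3], ![3, 1, 2], ![3, 1, 3], ![3, 2, 2], ![3, 2, 3],
        ![3, 4, 0], ![4, 0, 2], ![4, 0, 3], ![4, 2, 0], ![4, 3, 0]} := by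
  decide +kernel

theorem sum_glues {x : Fin 5 → ℕ} (h₂ : x 2 = x 1) (h₃ : x 3 = x 1) :
    ∑ p with Glues p 0, ∏ i, x (p i) = 6 * x 0 ^ 2 * x 1 ∧
    ∑ p with Glues p 1, ∏ i, x (p i) = 7 * x 0 * x 1 ^ 2 + x 0 ^ 2 * x 4 ∧
    ∑ p with Glues p 2, ∏ i, x (p i) = 7 * x 0 * x 1 ^ 2 + x 0 ^ 2 * x 4 ∧
    ∑ p with Glues p 3, ∏ i, x (p i) = 7 * x 0 * x 1 ^ 2 + x 0 ^ 2 * x 4 ∧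
    ∑ p with Glues p 4, ∏ i, x (p i) = 14 * x 1 ^ 3 + 12 * x 0 * x 1 * x 4 := by
  obtain ⟨g₀, g₁, g₂, g₃, g₄⟩ := filter_glues_val
  refine ⟨?_, ?_, ?_, ?_, ?_⟩
  all_goals
    simp only [Finset.sum, g₀, g₁, g₂, g₃, g₄, Multiset.insert_eq_cons, Multiset.map_cons,
      Multiset.map_singleton, Multiset.sum_cons, Multiset.sum_singleton, Fin.prod_univ_three,
      Matrix.cons_val, h₂, h₃]
    ring

theorem card_patternForests_symm (n : ℕ) :
    (patternForests n 2).card = (patternForests n 1).card ∧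
      (patternForests n 3).card = (patternForests n 1).card := by
  induction n with
  | zero => simp [card_patternForests_zero]
  | succ n ih =>
    obtain ⟨-, h₁, h₂, h₃, -⟩ := sum_glues (x := fun p => (patternForests n p).card) ih.1 ih.2
    simp only [card_patternForests_succ, h₁, h₂, h₃, and_self]

/-- recursion for the numbers of spanning trees and spanning forests. -/
theorem spanning_forest_recursion :
    (∀ n : ℕ,
        (treeSet (n + 1)).card = 6 * (treeSet n).card ^ 2 * (twoForestSet n 0).card ∧
        (twoForestSet (n + 1) 0).card =
          7 * (treeSet n).card * (twoForestSet n 0).card ^ 2 +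
            (treeSet n).card ^ 2 * (threeForestSet n).card ∧
        (threeForestSet (n + 1)).card =
          14 * (twoForestSet n 0).card ^ 3 +
            12 * (treeSet n).card * (twoForestSet n 0).card * (threeForestSet n).card) ∧
      (treeSet 0).card = 3 ∧ (twoForestSet 0 0).card = 1 ∧ (threeForestSet 0).card = 1 := by
  simp only [treeSet_eq_patternForests, twoForestSet_eq_patternForests,
    threeForestSet_eq_patternForests]
  refine ⟨fun n => ?_, by simp [card_patternForests_zero]⟩
  obtain ⟨h₂, h₃⟩ := card_patternForests_symm n
  obtain ⟨h₀, h₁, -, -, h₄⟩ := sum_glues (x := fun p => (patternForests n p).card) h₂ h₃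
  simp only [card_patternForests_succ n, h₀, h₁, h₄, and_self]

end
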